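/- arXiv:1707.02099 — 7 statements merged into one kernel-verified Lean document; each statement's English description precedes it below -/
import Mathlib

section
/- Let S=(𝒫,ℒ) be a non-degenerate polar space and let x,y∈𝒫 be points with x^⊥⊆y^⊥. Then x=y. -/
universe u

/-- A *partial linear space*: a set of points `P` together with a set `L` of
subsets of `P` of size at least `2` (the *lines*), such that two distinct
points lie on at most one common line. -/
structure PLS (P : Type u) where
  L : Set (Set P)
  nontrivial_lines : ∀ l ∈ L, Set.Nontrivial l
  unique_line : ∀ l ∈ L, ∀ m ∈ L, ∀ x y : P, x ≠ y →
    x ∈ l → y ∈ l → x ∈ m → y ∈ m → l = m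

namespace PLS

variable {P : Type u} (S : PLS P)

/-- `x ∼ y` : the points are distinct and lie on a common line. -/
def Collinear (x y : P) : Prop := x ≠ y ∧ ∃ l ∈ S.L, x ∈ l ∧ y ∈ l

/-- `x ⊥ y` : `x = y` or `x` and `y` are non-collinear. -/
def Perp (x y : P) : Prop := ¬ S.Collinear x y

/-- `x^⊥` : the set of points `y` with `x ⊥ y`. -/
def perpSet (x : P) : Set P := {y | S.Perp x y}

/-- Adjacency in the graph `(P, ⊥)` : distinct points with `x ⊥ y`. -/
def PerpAdj (x y : P) : Prop := x ≠ y ∧ S.Perp x y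

/-- `X^⊥` for a set `X` of points: points `⊥` to every point of `X`. -/
def setPerp (X : Set P) : Set P := {z | ∀ p ∈ X, S.Perp z p}

/-- `(xy)^{⊥⊥} = {z ∈ P : z ⊥ u for every u ∈ x^⊥ ∩ y^⊥}`. -/
def doublePerp (x y : P) : Set P :=
  {z | ∀ u ∈ S.perpSet x ∩ S.perpSet y, S.Perp z u}

/-- A subspace: every line meeting it in at least two points is contained in it. -/
def IsSubspace (X : Set P) : Prop :=
  ∀ l ∈ S.L, (∃ x ∈ l ∩ X, ∃ y ∈ l ∩ X, x ≠ y) → l ⊆ X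

/-- `⟨Y⟩`, the subspace generated by `Y`. -/
def span (Y : Set P) : Set P := ⋂₀ {X | S.IsSubspace X ∧ Y ⊆ X}

/-- A plane: the subspace generated by two distinct lines meeting in a point. -/
def IsPlane (X : Set P) : Prop :=
  ∃ l ∈ S.L, ∃ m ∈ S.L, l ≠ m ∧ (l ∩ m).Nonempty ∧ X = S.span (l ∪ m)

/-- A transversal plane: a plane `X` such that for every line `ℓ ⊆ X` the sets
`x^⊥ ∩ X`, for `x ∈ ℓ`, partition `X` (every point of `X` lies in exactly one
of them). -/
def IsTransversalPlane (X : Set P) : Prop :=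
  S.IsPlane X ∧ ∀ l ∈ S.L, l ⊆ X → ∀ p ∈ X, ∃! x, x ∈ l ∧ S.Perp x p

/-- `T` is a transversal of `X`: `T = x^⊥ ∩ X` for a point `x` on a line of `X`. -/
def IsTransversalOf (T X : Set P) : Prop :=
  ∃ l ∈ S.L, l ⊆ X ∧ ∃ x ∈ l, T = S.perpSet x ∩ X

/-- Connectedness of the collinearity graph `(P, ∼)`. -/
def Connected : Prop := ∀ x y : P, Relation.ReflTransGen S.Collinear x y

/-- Connectedness of the graph `(P, ⊥)`. -/
def CoConnected : Prop := ∀ x y : P, Relation.ReflTransGen S.PerpAdj x y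

/-- The one-or-all axiom for polar spaces. -/
def IsPolar : Prop :=
  ∀ p : P, ∀ l ∈ S.L, p ∉ l →
    (∃! q, q ∈ l ∧ S.Collinear p q) ∨ (∀ q ∈ l, S.Collinear p q)

/-- Non-degeneracy: the radical is empty, i.e. no point is collinear with all
other points. -/
def Nondegenerate : Prop := ∀ p : P, ∃ q, q ≠ p ∧ ¬ S.Collinear p q

/-- In a polar space, `p^⊥` denotes the points equal or collinear to `p`. -/
def polarPerp (x : P) : Set P := {q | q = x ∨ S.Collinear x q}

/-- `X^⊥` in a polar space, for a set of points `X`. -/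
def polarPerpSet (X : Set P) : Set P := {q | ∀ x ∈ X, q ∈ S.polarPerp x}

/-- The hyperbolic line on two non-collinear points of a polar space:
`{z : z ∈ u^⊥ for every u ∈ x^⊥ ∩ y^⊥}`. -/
def polarHypLine (x y : P) : Set P :=
  {z | ∀ u ∈ S.polarPerp x ∩ S.polarPerp y, z ∈ S.polarPerp u}

/-- A linear set: any two of its distinct points are collinear. -/
def IsLinearSet (X : Set P) : Prop := ∀ x ∈ X, ∀ y ∈ X, x ≠ y → S.Collinear x y

/-- Planarity: any two distinct lines meeting in a point are contained in a
unique plane. -/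
def Planar : Prop :=
  ∀ l ∈ S.L, ∀ m ∈ S.L, l ≠ m → (l ∩ m).Nonempty →
    ∃! π, S.IsPlane π ∧ l ⊆ π ∧ m ⊆ π

/-- A projective plane: a linear space in which any two distinct lines meet in
a point, containing four points no three of which are collinear. -/
def IsProjectivePlane : Prop :=
  (∀ x y : P, x ≠ y → ∃ l ∈ S.L, x ∈ l ∧ y ∈ l) ∧
  (∀ l ∈ S.L, ∀ m ∈ S.L, l ≠ m → (l ∩ m).Nonempty) ∧
  (∃ a b c d : P, a ≠ b ∧ a ≠ c ∧ a ≠ d ∧ b ≠ c ∧ b ≠ d ∧ c ≠ d ∧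
    ∀ l ∈ S.L, ¬(a ∈ l ∧ b ∈ l ∧ c ∈ l) ∧ ¬(a ∈ l ∧ b ∈ l ∧ d ∈ l) ∧
      ¬(a ∈ l ∧ c ∈ l ∧ d ∈ l) ∧ ¬(b ∈ l ∧ c ∈ l ∧ d ∈ l))

/-- `π` is isomorphic to a dual affine plane: there is a projective plane `T`
on a point set `Q`, a point `p` of `T`, and a bijection from `π` onto `Q ∖ {p}`
under which the lines of `Π` contained in `π` correspond exactly to the lines
of `T` not passing through `p`. -/
def IsDualAffine (π : Set P) : Prop :=
  ∃ (Q : Type u) (T : PLS Q) (p : Q) (f : P → Q),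
    T.IsProjectivePlane ∧ Set.BijOn f π {q | q ≠ p} ∧
    ∀ s : Set P, s ⊆ π → (s ∈ S.L ↔ f '' s ∈ T.L ∧ p ∉ f '' s)

/-- A linear plane contains four distinct lines which pairwise meet and whose
pairwise intersection points are six distinct points. -/
def FourLinesSixPoints (π : Set P) : Prop :=
  ∃ l : Fin 4 → Set P, (∀ i, l i ∈ S.L ∧ l i ⊆ π) ∧ Function.Injective l ∧
    ∃ pt : Fin 4 → Fin 4 → P,
      (∀ i j, i < j → pt i j ∈ l i ∩ l j) ∧
      (∀ i j k m, i < j → k < m → (i, j) ≠ (k, m) → pt i j ≠ pt k m)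

/-- Conditions (a)–(d) of the Main Hypothesis, for a connected and co-connected
partial linear space:
(a) all lines have at least `4` points;
(b) `x^⊥ ⊆ y^⊥` implies `x = y`;
(c) every triple `x ∼ y ∼ z`, `x ⊥ z`, `x ≠ z`, generates a transversal plane;
(d) for every point `p` and transversal plane `π`, `p^⊥ ∩ π` is empty, a
point, a line, or a transversal of `π`. -/
def MainHyp : Prop :=
  S.Connected ∧ S.CoConnected ∧
  (∀ l ∈ S.L, 4 ≤ Cardinal.mk ↥l) ∧
  (∀ x y : P, S.perpSet x ⊆ S.perpSet y → x = y) ∧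
  (∀ x y z : P, S.Collinear x y → S.Collinear y z → S.PerpAdj x z →
    S.IsTransversalPlane (S.span {x, y, z})) ∧
  (∀ p : P, ∀ π : Set P, S.IsTransversalPlane π →
    S.perpSet p ∩ π = ∅ ∨ (∃ q, S.perpSet p ∩ π = {q}) ∨
    S.perpSet p ∩ π ∈ S.L ∨ S.IsTransversalOf (S.perpSet p ∩ π) π)

/-- Conditions (a)–(e) of the Setting, for a connected partial linear space:
(a) all lines have at least `4` points;
(b) `x^⊥ ⊆ y^⊥` implies `x^⊥ = y^⊥`;
(c) there exist two distinct non-collinear points;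
(d) every triple `x ∼ y ∼ z`, `x ⊥ z`, `x ≠ z`, is contained in a transversal
plane;
(e) for every point `p` and transversal plane `π`, `p^⊥ ∩ π` is empty, a
point, a line, a transversal of `π`, or `π` itself. -/
def Setting : Prop :=
  S.Connected ∧
  (∀ l ∈ S.L, 4 ≤ Cardinal.mk ↥l) ∧
  (∀ x y : P, S.perpSet x ⊆ S.perpSet y → S.perpSet x = S.perpSet y) ∧
  (∃ x y : P, x ≠ y ∧ ¬ S.Collinear x y) ∧
  (∀ x y z : P, S.Collinear x y → S.Collinear y z → S.PerpAdj x z →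
    ∃ π, S.IsTransversalPlane π ∧ x ∈ π ∧ y ∈ π ∧ z ∈ π) ∧
  (∀ p : P, ∀ π : Set P, S.IsTransversalPlane π →
    S.perpSet p ∩ π = ∅ ∨ (∃ q, S.perpSet p ∩ π = {q}) ∨
    S.perpSet p ∩ π ∈ S.L ∨ S.IsTransversalOf (S.perpSet p ∩ π) π ∨
    S.perpSet p ∩ π = π)

end PLS

theorem PLS.aux_symm {P : Type u} (S : PLS P) {a b : P} (h : b ∈ S.polarPerp a) :
    a ∈ S.polarPerp b := by
  rcases h with h | ⟨h, l, hl, ha, hb⟩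
  · exact Or.inl h.symm
  · exact Or.inr ⟨h.symm, l, hl, hb, ha⟩

theorem PLS.aux_line {P : Type u} (S : PLS P) {a b : P} {l : Set P} (hl : l ∈ S.L)
    (ha : a ∈ l) (hb : b ∈ l) : b ∈ S.polarPerp a := by
  by_cases h : b = a
  · exact Or.inl h
  · exact Or.inr ⟨fun e => h e.symm, l, hl, ha, hb⟩

theorem PLS.aux_all {P : Type u} (S : PLS P) (hp : S.IsPolar) {a u v w : P} {l : Set P}
    (hl : l ∈ S.L) (hu : u ∈ l) (hv : v ∈ l) (hw : w ∈ l) (huv : u ≠ v)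
    (h1 : u ∈ S.polarPerp a) (h2 : v ∈ S.polarPerp a) : w ∈ S.polarPerp a := by
  by_cases ha : a ∈ l
  · exact S.aux_line hl ha hw
  · have h1' : S.Collinear a u := h1.resolve_left (fun e => ha (e ▸ hu))
    have h2' : S.Collinear a v := h2.resolve_left (fun e => ha (e ▸ hv))
    rcases hp a l hl ha with h | h
    · exact absurd (h.unique ⟨hu, h1'⟩ ⟨hv, h2'⟩) huv
    · exact Or.inr (h w hw)

theorem PLS.aux_one {P : Type u} (S : PLS P) (hp : S.IsPolar) (a : P) {l : Set P}
    (hl : l ∈ S.L) : ∃ q ∈ l, q ∈ S.polarPerp a := by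
  by_cases ha : a ∈ l
  · exact ⟨a, ha, Or.inl rfl⟩
  · rcases hp a l hl ha with ⟨q, hq, _⟩ | h
    · exact ⟨q, hq.1, Or.inr hq.2⟩
    · obtain ⟨q, hq⟩ := (S.nontrivial_lines l hl).nonempty
      exact ⟨q, hq, Or.inr (h q hq)⟩

/-- 2.2. In a non-degenerate polar space, `x^⊥ ⊆ y^⊥`
implies `x = y`. -/
theorem polar_nondegenerate_perp {P : Type u} (S : PLS P)
    (hpolar : S.IsPolar) (hnd : S.Nondegenerate)
    (x y : P) (h : S.polarPerp x ⊆ S.polarPerp y) : x = y := by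
  by_contra hxy
  have nd : ∀ p, ∃ q, q ∉ S.polarPerp p := fun p => by
    obtain ⟨q, h1, h2⟩ := hnd p
    exact ⟨q, fun e => e.elim h1 h2⟩
  obtain ⟨-, l, hl, hyl, hxl⟩ := (h (Or.inl rfl : x ∈ S.polarPerp x)).resolve_left hxy
  obtain ⟨z, hz⟩ := nd y
  have hxz : z ∉ S.polarPerp x := fun e => hz (h e)
  obtain ⟨q, hql, hzq⟩ := S.aux_one hpolar z hl
  have hqz : q ≠ z := fun e => hz (S.aux_line hl hyl (e ▸ hql))
  obtain ⟨-, m, hm, hzm, hqm⟩ := hzq.resolve_left hqz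
  obtain ⟨w, hw⟩ := nd q
  obtain ⟨r, hrm, hwr⟩ := S.aux_one hpolar w hm
  have hrq : r ≠ q := fun e => hw (S.aux_symm (e ▸ hwr))
  have hxr : r ∉ S.polarPerp x := fun e =>
    hxz (S.aux_all hpolar hm hrm hqm hzm hrq e (S.aux_line hl hxl hql))
  have hrw : r ≠ w := fun e => hw (S.aux_line hm hqm (e ▸ hrm))
  obtain ⟨-, n, hn, hwn, hrn⟩ := hwr.resolve_left hrw
  obtain ⟨s, hsn, hxs⟩ := S.aux_one hpolar x hn
  have hsr : s ≠ r := fun e => hxr (e ▸ hxs)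
  have hsq : q ∈ S.polarPerp s :=
    S.aux_all hpolar hl hxl hyl hql hxy (S.aux_symm hxs) (S.aux_symm (h hxs))
  exact hw (S.aux_all hpolar hn hsn hrn hwn hsr (S.aux_symm hsq) (S.aux_line hm hqm hrm))
end

section
/- Let S=(𝒫,ℒ) be a thick non-degenerate polar space, let x,y∈𝒫 be two distinct non-collinear points, and let H={x,y}^{⊥⊥} be the hyperbolic line on x and y. Then for any two distinct points z₁,z₂∈H, the points z₁ and z₂ are non-collinear and H={z₁,z₂}^{⊥⊥}. -/
universe u

namespace PLS
variable {P : Type u} {S : PLS P}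

theorem hl_symm {a b : P} (h : b ∈ S.polarPerp a) : a ∈ S.polarPerp b := by
  rcases h with h | ⟨h, l, hl, ha, hb⟩
  · exact Or.inl h.symm
  · exact Or.inr ⟨h.symm, l, hl, hb, ha⟩

theorem hl_refl (a : P) : a ∈ S.polarPerp a := Or.inl rfl

theorem hl_on {l : Set P} (hl : l ∈ S.L) {a b : P} (ha : a ∈ l) (hb : b ∈ l) :
    b ∈ S.polarPerp a := by
  by_cases h : b = a
  · exact Or.inl h
  · exact Or.inr ⟨fun e => h e.symm, l, hl, ha, hb⟩

theorem hl_line {a b : P} (h : b ∈ S.polarPerp a) (hne : a ≠ b) :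
    ∃ l ∈ S.L, a ∈ l ∧ b ∈ l := by
  rcases h with h | ⟨_, h⟩
  · exact absurd h.symm hne
  · exact h

theorem hl_ex (hp : S.IsPolar) {l : Set P} (hl : l ∈ S.L) (p : P) :
    ∃ q ∈ l, q ∈ S.polarPerp p := by
  by_cases h : p ∈ l
  · exact ⟨p, h, hl_refl p⟩
  · rcases hp p l hl h with ⟨q, ⟨hq, hc⟩, _⟩ | h'
    · exact ⟨q, hq, Or.inr hc⟩
    · obtain ⟨q, hq, _⟩ := S.nontrivial_lines l hl
      exact ⟨q, hq, Or.inr (h' q hq)⟩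

theorem hl_sub (hp : S.IsPolar) {l : Set P} (hl : l ∈ S.L) {p a b c : P}
    (ha : a ∈ l) (hb : b ∈ l) (hc : c ∈ l) (hab : a ≠ b)
    (hpa : a ∈ S.polarPerp p) (hpb : b ∈ S.polarPerp p) : c ∈ S.polarPerp p := by
  by_cases h : p ∈ l
  · exact hl_on hl h hc
  · have hpa' : S.Collinear p a := hpa.resolve_left (fun e => h (e ▸ ha))
    have hpb' : S.Collinear p b := hpb.resolve_left (fun e => h (e ▸ hb))
    rcases hp p l hl h with hu | h'
    · exact absurd (hu.unique ⟨ha, hpa'⟩ ⟨hb, hpb'⟩) hab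
    · exact Or.inr (h' c hc)

theorem hl_mem {x y q : P} :
    q ∈ S.polarPerpSet {x, y} ↔ q ∈ S.polarPerp x ∧ q ∈ S.polarPerp y := by
  simp [polarPerpSet]

/-- `{x,y}^⊥` has empty radical. -/
theorem hl_rad (hp : S.IsPolar) (hnd : S.Nondegenerate) {x y r : P}
    (hxy : y ∉ S.polarPerp x) (hr : r ∈ S.polarPerpSet {x, y})
    (hr' : r ∈ S.polarPerpSet (S.polarPerpSet {x, y})) : False := by
  obtain ⟨hrx, hry⟩ := hl_mem.1 hr
  have key : ∀ {x y : P}, y ∉ S.polarPerp x → r ∈ S.polarPerp x →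
      (∀ w, w ∈ S.polarPerp x → w ∈ S.polarPerp y → w ∈ S.polarPerp r) →
      ∀ q, q ∈ S.polarPerp x → q ∈ S.polarPerp r := by
    intro x y hxy hrx hw q hq
    by_cases e : x = q
    · exact e ▸ hl_symm hrx
    obtain ⟨l, hl, hx, hql⟩ := hl_line hq e
    obtain ⟨w, hwl, hwy⟩ := hl_ex hp hl y
    have hxw : x ≠ w := by
      rintro rfl
      exact hxy (hl_symm hwy)
    exact hl_sub hp hl hx hwl hql hxw (hl_symm hrx) (hw w (hl_on hl hx hwl) hwy)
  have hw : ∀ w, w ∈ S.polarPerp x → w ∈ S.polarPerp y → w ∈ S.polarPerp r :=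
    fun w h1 h2 => hl_symm (hr' w (hl_mem.2 ⟨h1, h2⟩))
  have kx := key hxy hrx hw
  have ky := key (fun h => hxy (hl_symm h)) hry (fun w h1 h2 => hw w h2 h1)
  obtain ⟨p, hpr, hpc⟩ := hnd r
  have hpn : p ∉ S.polarPerp r := fun h => h.elim hpr hpc
  have hxr : x ≠ r := by
    rintro rfl
    exact hxy (hl_symm hry)
  obtain ⟨l, hl, hx, hrl⟩ := hl_line hrx hxr
  obtain ⟨a, hal, hpa⟩ := hl_ex hp hl p
  have har : r ≠ a := by
    rintro rfl
    exact hpn (hl_symm hpa)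
  have hay : a ∉ S.polarPerp y := fun h =>
    hxy (hl_symm (hl_sub hp hl hrl hal hx har hry h))
  have hra : a ∈ S.polarPerp r := hl_on hl hrl hal
  have hpa' : p ≠ a := by
    rintro rfl
    exact hpn hra
  obtain ⟨m, hm, hpm, ham⟩ := hl_line hpa hpa'
  obtain ⟨b, hbm, hby⟩ := hl_ex hp hm y
  have hab : a ≠ b := by
    rintro rfl
    exact hay hby
  exact hpn (hl_sub hp hm ham hbm hpm hab hra (ky b hby))

theorem hl_tangent (hp : S.IsPolar) (hnd : S.Nondegenerate) {x y a : P}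
    (hxy : y ∉ S.polarPerp x)
    (ha : a ∈ S.polarPerpSet (S.polarPerpSet {x, y}))
    (hax : a ∈ S.polarPerp x) : a = x := by
  by_contra hne
  obtain ⟨l, hl, hx, hal⟩ := hl_line hax (fun e => hne e.symm)
  obtain ⟨b, hbl, hby⟩ := hl_ex hp hl y
  refine hl_rad hp hnd (r := b) hxy (hl_mem.2 ⟨hl_on hl hx hbl, hby⟩) ?_
  intro w hw
  exact hl_sub hp hl hal hx hbl hne (ha w hw) (hl_symm (hl_mem.1 hw).1)

theorem hl_noncol (hp : S.IsPolar) (hnd : S.Nondegenerate) {x y z₁ z₂ : P}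
    (hxy : y ∉ S.polarPerp x)
    (hz₁ : z₁ ∈ S.polarPerpSet (S.polarPerpSet {x, y}))
    (hz₂ : z₂ ∈ S.polarPerpSet (S.polarPerpSet {x, y}))
    (hne : z₁ ≠ z₂) : z₂ ∉ S.polarPerp z₁ := by
  intro h
  obtain ⟨l, hl, h1, h2⟩ := hl_line h hne
  have hlH : ∀ c ∈ l, c ∈ S.polarPerpSet (S.polarPerpSet {x, y}) :=
    fun c hc w hw => hl_sub hp hl h1 h2 hc hne (hz₁ w hw) (hz₂ w hw)
  obtain ⟨a, hal, hax⟩ := hl_ex hp hl x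
  obtain ⟨b, hbl, hby⟩ := hl_ex hp hl y
  have e1 := hl_tangent hp hnd hxy (hlH a hal) hax
  have e2 := hl_tangent hp hnd (fun h => hxy (hl_symm h))
    (by rw [Set.pair_comm]; exact hlH b hbl) hby
  subst e1 e2
  exact hxy (hl_on hl hal hbl)

theorem hl_exch (hp : S.IsPolar) {x y z : P}
    (hxy : y ∉ S.polarPerp x)
    (hz : z ∈ S.polarPerpSet (S.polarPerpSet {x, y}))
    (hxz : z ∉ S.polarPerp x) :
    S.polarPerpSet {x, y} = S.polarPerpSet {x, z} := by
  ext u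
  constructor
  · intro hu
    exact hl_mem.2 ⟨(hl_mem.1 hu).1, hl_symm (hz u hu)⟩
  · intro hu
    obtain ⟨hux, huz⟩ := hl_mem.1 hu
    have hne : x ≠ u := by
      rintro rfl
      exact hxz (hl_symm huz)
    obtain ⟨l, hl, hx, hul⟩ := hl_line hux hne
    obtain ⟨w, hwl, hwy⟩ := hl_ex hp hl y
    have hwW : w ∈ S.polarPerpSet {x, y} := hl_mem.2 ⟨hl_on hl hx hwl, hwy⟩
    by_cases e : w = u
    · exact e ▸ hwW
    · exact absurd (hl_symm (hl_sub hp hl hwl hul hx e (hl_symm (hz w hwW)) huz)) hxz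

end PLS

/-- 2.3. In a thick non-degenerate polar space, any two
distinct points `z₁, z₂` of a hyperbolic line `H = {x,y}^{⊥⊥}` are
non-collinear, and `H = {z₁,z₂}^{⊥⊥}`. -/
theorem polar_hyperbolic_line {P : Type u} (S : PLS P)
    (hpolar : S.IsPolar) (hnd : S.Nondegenerate)
    (hthick : ∀ l ∈ S.L, 3 ≤ Cardinal.mk ↥l)
    (x y : P) (hxy : x ≠ y) (hncol : ¬ S.Collinear x y)
    (z₁ z₂ : P)
    (hz₁ : z₁ ∈ S.polarPerpSet (S.polarPerpSet {x, y}))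
    (hz₂ : z₂ ∈ S.polarPerpSet (S.polarPerpSet {x, y}))
    (hne : z₁ ≠ z₂) :
    ¬ S.Collinear z₁ z₂ ∧
      S.polarPerpSet (S.polarPerpSet {x, y}) =
        S.polarPerpSet (S.polarPerpSet {z₁, z₂}) := by
  have hxy' : y ∉ S.polarPerp x := fun h => h.elim (fun e => hxy e.symm) hncol
  have h12 := PLS.hl_noncol hpolar hnd hxy' hz₁ hz₂ hne
  refine ⟨fun h => h12 (Or.inr h), ?_⟩
  by_cases e : z₁ = x
  · subst e
    rw [PLS.hl_exch hpolar hxy' hz₂ h12]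
  · have hx : x ∈ S.polarPerpSet (S.polarPerpSet {x, y}) :=
      fun w hw => PLS.hl_symm (PLS.hl_mem.1 hw).1
    have hx1 := PLS.hl_noncol hpolar hnd hxy' hx hz₁ (fun h => e h.symm)
    have e1 := PLS.hl_exch hpolar hxy' hz₁ hx1
    rw [e1, Set.pair_comm] at hz₂
    rw [e1, Set.pair_comm x z₁,
      PLS.hl_exch hpolar (fun h => hx1 (PLS.hl_symm h)) hz₂ h12]
end

section
/- Let Π=(P,L) be a connected partial linear space satisfying conditions (a)–(e) of the Setting. Then for every point x and every line l of Π, either x is collinear with no point of l, or x is collinear with all points of l, or x is collinear with all points of l except exactly one. -/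
universe u

/-- 3.2. In the Setting, a point is collinear with no point
of a line, with all points of it, or with all its points except exactly one. -/
theorem delta_space {P : Type u} (S : PLS P) (h : S.Setting)
    (x : P) (l : Set P) (hl : l ∈ S.L) :
    (∀ p ∈ l, ¬ S.Collinear x p) ∨ (∀ p ∈ l, S.Collinear x p) ∨
    (∃ p ∈ l, ¬ S.Collinear x p ∧ ∀ q ∈ l, q ≠ p → S.Collinear x q) := by
  classical
  have symm : ∀ a b, S.Collinear a b → S.Collinear b a := by
    rintro a b ⟨hne, m, hm, ha, hb⟩
    exact ⟨hne.symm, m, hm, hb, ha⟩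
  by_cases h1 : ∀ p ∈ l, ¬ S.Collinear x p
  · exact Or.inl h1
  by_cases h2 : ∀ p ∈ l, S.Collinear x p
  · exact Or.inr (Or.inl h2)
  right; right
  push Not at h1 h2
  obtain ⟨y, hy, hxy⟩ := h1
  obtain ⟨z, hz, hxz⟩ := h2
  refine ⟨z, hz, hxz, ?_⟩
  by_cases he : x = z
  · subst he
    intro q hq hne
    exact ⟨hne.symm, l, hl, hz, hq⟩
  have hyz : y ≠ z := by
    rintro rfl
    exact hxz hxy
  obtain ⟨-, -, -, -, hd, -⟩ := h
  obtain ⟨X, ⟨⟨m, hm, n, hn, -, -, rfl⟩, hT⟩, hxX, hyX, hzX⟩ :=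
    hd x y z hxy ⟨hyz, l, hl, hy, hz⟩ ⟨he, hxz⟩
  have hlX : l ⊆ S.span (m ∪ n) := by
    intro q hq Y hY
    exact hY.1 l hl ⟨y, ⟨hy, hyX Y hY⟩, z, ⟨hz, hzX Y hY⟩, hyz⟩ hq
  intro q hq hne
  by_contra hc
  exact hne ((hT l hl hlX x hxX).unique ⟨hq, fun h => hc (symm _ _ h)⟩
    ⟨hz, fun h => hxz (symm _ _ h)⟩)
end

section
/- Let Π=(P,L) be a connected partial linear space satisfying conditions (a)–(e) of the Setting. Then for every point x∈P, both x^⊥ and x^⊥∖{x} are subspaces of Π. -/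
universe u

theorem perp_aux {P : Type u} (S : PLS P) (h : S.Setting) (x : P) :
    S.IsSubspace (S.perpSet x) := by
  obtain ⟨-, -, -, -, hd, -⟩ := h
  rintro l hl ⟨a, ⟨hal, hax⟩, b, ⟨hbl, hbx⟩, hab⟩ c hcl
  change ¬ S.Collinear x c
  intro hxc
  have hax' : ¬ S.Collinear x a := hax
  have hbx' : ¬ S.Collinear x b := hbx
  have hxa : x ≠ a := by
    rintro rfl
    exact hbx' ⟨hab, l, hl, hal, hbl⟩
  have hca : c ≠ a := by
    rintro rfl
    exact hax' hxc
  obtain ⟨π, hπ, hxπ, hcπ, haπ⟩ := hd x c a hxc ⟨hca, l, hl, hcl, hal⟩ ⟨hxa, hax⟩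
  obtain ⟨⟨m, hm, n, hn, -, -, hπe⟩, ht⟩ := hπ
  have hlπ : l ⊆ π := by
    intro d hd
    rw [hπe] at hcπ haπ ⊢
    intro X hX
    exact hX.1 l hl ⟨c, ⟨hcl, hcπ X hX⟩, a, ⟨hal, haπ X hX⟩, hca⟩ hd
  have symm : ∀ y, ¬ S.Collinear x y → S.Perp y x := by
    rintro y hy ⟨hne, k, hk, h1, h2⟩
    exact hy ⟨hne.symm, k, hk, h2, h1⟩
  exact hab ((ht l hl hlπ x hxπ).unique ⟨hal, symm a hax'⟩ ⟨hbl, symm b hbx'⟩)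

/-- 3.4. In the Setting, `x^⊥` and `x^⊥ ∖ {x}` are
subspaces. -/
theorem perp_is_subspace {P : Type u} (S : PLS P) (h : S.Setting) (x : P) :
    S.IsSubspace (S.perpSet x) ∧ S.IsSubspace (S.perpSet x \ {x}) := by
  refine ⟨perp_aux S h x, ?_⟩
  rintro l hl ⟨a, ⟨hal, hax, -⟩, b, ⟨hbl, hbx, -⟩, hab⟩ c hcl
  refine ⟨perp_aux S h x l hl ⟨a, ⟨hal, hax⟩, b, ⟨hbl, hbx⟩, hab⟩ hcl, ?_⟩
  rintro rfl
  by_cases hca : c = a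
  · subst hca
    exact hbx ⟨hab, l, hl, hal, hbl⟩
  · exact hax ⟨hca, l, hl, hcl, hal⟩
end

section
/- Let Π=(P,L) be a connected partial linear space satisfying conditions (a)–(e) of the Setting, and let X be a subspace of Π whose induced collinearity graph is connected. Then any two distinct points of X are joined by a path of length at most 2 in the collinearity graph restricted to X; in particular every connected subspace of Π has diameter at most 2. -/
universe u

namespace PLS

theorem Collinear.symm' {P : Type u} {S : PLS P} {x y : P} (h : S.Collinear x y) :
    S.Collinear y x := by
  obtain ⟨h1, l, hl, hx, hy⟩ := h
  exact ⟨h1.symm, l, hl, hy, hx⟩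

theorem span_isSubspace {P : Type u} (S : PLS P) (Y : Set P) : S.IsSubspace (S.span Y) := by
  rintro l hl ⟨x, ⟨hxl, hx⟩, y, ⟨hyl, hy⟩, hne⟩ p hp Z hZ
  exact hZ.1 l hl ⟨x, ⟨hxl, hx Z hZ⟩, y, ⟨hyl, hy Z hZ⟩, hne⟩ hp

theorem key {P : Type u} (S : PLS P) (h : S.Setting) {a b c : P} (hab : S.Collinear a b)
    (hac : S.PerpAdj a c) {l : Set P} (hl : l ∈ S.L) (hb : b ∈ l) (hc : c ∈ l) (hbc : b ≠ c)
    {z : P} (hz : z ∈ l) (hzc : z ≠ c) : S.Collinear a z := by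
  obtain ⟨-, -, -, -, hd, -⟩ := h
  obtain ⟨π, ⟨⟨l1, -, m1, -, -, -, rfl⟩, ht⟩, haπ, hbπ, hcπ⟩ :=
    hd a b c hab ⟨hbc, l, hl, hb, hc⟩ hac
  have hsub := span_isSubspace S _ l hl ⟨b, ⟨hb, hbπ⟩, c, ⟨hc, hcπ⟩, hbc⟩
  obtain ⟨w, -, hw⟩ := ht l hl hsub a haπ
  by_contra hn
  exact hzc ((hw z ⟨hz, fun q => hn q.symm'⟩).trans (hw c ⟨hc, fun q => hac.2 q.symm'⟩).symm)

theorem third {P : Type u} (S : PLS P) (h : S.Setting) {l : Set P} (hl : l ∈ S.L) (b c : P) :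
    ∃ z ∈ l, z ≠ b ∧ z ≠ c := by
  by_contra! hn
  have h4 := h.2.1 l hl
  have hs : l ⊆ {b, c} := by
    intro z hz
    by_cases hzb : z = b
    · simp [hzb]
    · simp [hn z hz hzb]
  have h2 : Cardinal.mk ↥l ≤ 2 := by
    refine (Cardinal.mk_le_mk_of_subset hs).trans ?_
    refine Cardinal.mk_insert_le.trans ?_
    rw [Cardinal.mk_singleton]
    norm_num
  have := h4.trans h2
  norm_num at this

end PLS

/-- 3.5. In the Setting, every connected subspace has
diameter at most `2`: any two distinct points of a connected subspace `X` are
joined in the collinearity graph restricted to `X` by a path of length at most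
`2`. -/
theorem subspace_diameter_two {P : Type u} (S : PLS P) (h : S.Setting)
    (X : Set P) (hX : S.IsSubspace X)
    (hconn : ∀ a ∈ X, ∀ b ∈ X,
      Relation.ReflTransGen (fun u v => u ∈ X ∧ v ∈ X ∧ S.Collinear u v) a b) :
    ∀ a ∈ X, ∀ b ∈ X, a ≠ b →
      S.Collinear a b ∨ ∃ z ∈ X, S.Collinear a z ∧ S.Collinear z b := by
  intro a ha b hb hab
  have main : a = b ∨ S.Collinear a b ∨ ∃ z ∈ X, S.Collinear a z ∧ S.Collinear z b := by
    clear hab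
    have hp := hconn a ha b hb
    clear hb
    induction hp with
    | refl => exact Or.inl rfl
    | @tail c d _ hcd ih =>
      obtain ⟨hc, hd, hcd⟩ := hcd
      rcases ih with rfl | ih | ⟨b, hb, hab, hbc⟩
      · exact Or.inr (Or.inl hcd)
      · exact Or.inr (Or.inr ⟨c, hc, ih, hcd⟩)
      · by_cases hac : a = c
        · subst hac
          exact Or.inr (Or.inl hcd)
        by_cases hac' : S.Collinear a c
        · exact Or.inr (Or.inr ⟨c, hc, hac', hcd⟩)
        by_cases hbd : b = d
        · subst hbd
          exact Or.inr (Or.inl hab)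
        by_cases hbd' : S.Collinear b d
        · exact Or.inr (Or.inr ⟨b, hb, hab, hbd'⟩)
        obtain ⟨hne, l, hl, hbl, hcl⟩ := hbc
        obtain ⟨z, hz, hzb, hzc⟩ := S.third h hl b c
        have h1 := S.key h hab ⟨hac, hac'⟩ hl hbl hcl hne hz hzc
        have h2 := S.key h hcd.symm' ⟨Ne.symm hbd, fun q => hbd' q.symm'⟩ hl hcl hbl
          hne.symm hz hzb
        exact Or.inr (Or.inr ⟨z, hX l hl ⟨b, ⟨hbl, hb⟩, c, ⟨hcl, hc⟩, hne⟩ hz, h1, h2.symm'⟩)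
  exact main.resolve_left hab
end

section
/- Let Π=(P,L) be a connected partial linear space satisfying conditions (a)–(e) of the Setting. Let π be a transversal plane and l a line with l∩π={x} for some point x. If for some y∈l∖{x} the set y^⊥∩π is a transversal of π, then for every y∈l∖{x} the set y^⊥∩π is a transversal of π. If for some y∈l∖{x} the set y^⊥∩π is a line of Π contained in π, then for every y∈l∖{x} the set y^⊥∩π is a line of Π contained in π. -/
universe u

namespace PLS

theorem perp_symm' {P : Type u} {S : PLS P} {p q : P} (h : S.Perp p q) : S.Perp q p := by
  rintro ⟨h1, l, hl, h2, h3⟩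
  exact h ⟨h1.symm, l, hl, h3, h2⟩

theorem plane_sub {P : Type u} {S : PLS P} {π : Set P} (hπ : S.IsTransversalPlane π)
    {l : Set P} (hl : l ∈ S.L) {a b : P} (ha : a ∈ l) (hb : b ∈ l) (hab : a ≠ b)
    (ha' : a ∈ π) (hb' : b ∈ π) : l ⊆ π := by
  obtain ⟨⟨l0, _, m0, _, _, _, rfl⟩, _⟩ := hπ
  intro p hp X hX
  exact hX.1 l hl ⟨a, ⟨ha, ha' X hX⟩, b, ⟨hb, hb' X hX⟩, hab⟩ hp

theorem perp_trans' {P : Type u} {S : PLS P} {π : Set P} (hπ : S.IsTransversalPlane π)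
    {p q r : P} (hp : p ∈ π) (hq : q ∈ π) (hr : r ∈ π) (h1 : S.Perp p q) (h2 : S.Perp q r) :
    S.Perp p r := by
  rintro ⟨hne, k, hk, hpk, hrk⟩
  exact hne ((hπ.2 k hk (plane_sub hπ hk hpk hrk hne hp hr) q hq).unique
    ⟨hpk, h1⟩ ⟨hrk, perp_symm' h2⟩)

theorem proj_pt {P : Type u} {S : PLS P} (h : S.Setting) {l : Set P} (hl : l ∈ S.L)
    {x y z t : P} (hx : x ∈ l) (hy : y ∈ l) (hz : z ∈ l) (hyx : y ≠ x) (hzx : z ≠ x)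
    {k : Set P} (hk : k ∈ S.L) (hxk : x ∈ k) (htk : t ∈ k) (hxt : x ≠ t) (hty : y ≠ t)
    (hp : S.Perp y t) : ∃ s ∈ k, s ≠ x ∧ S.Perp z s := by
  obtain ⟨_, _, _, _, hd, _⟩ := h
  obtain ⟨π, hπ, h1, h2, h3⟩ := hd y x t ⟨hyx, l, hl, hy, hx⟩ ⟨hxt, k, hk, hxk, htk⟩ ⟨hty, hp⟩
  have hlπ := plane_sub hπ hl hx hy hyx.symm h2 h1
  have hkπ := plane_sub hπ hk hxk htk hxt h2 h3
  obtain ⟨s, ⟨hs, hs'⟩, _⟩ := hπ.2 k hk hkπ z (hlπ hz)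
  refine ⟨s, hs, ?_, perp_symm' hs'⟩
  rintro rfl
  exact hs' ⟨hzx.symm, l, hl, hx, hz⟩

theorem excl {P : Type u} {S : PLS P} (h : S.Setting) {π : Set P} (hπ : S.IsTransversalPlane π)
    {l : Set P} (hl : l ∈ S.L)
    {x y z : P} (hx : x ∈ l) (hy : y ∈ l) (hz : z ∈ l) (hyx : y ≠ x) (hzx : z ≠ x)
    (hxπ : x ∈ π) (hyπ : y ∉ π)
    (hT : S.IsTransversalOf (S.perpSet y ∩ π) π) (hm : S.perpSet z ∩ π ∈ S.L) : False := by
  obtain ⟨u, ⟨hu, hux⟩, _⟩ := hπ.2 _ hm Set.inter_subset_right x hxπ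
  have huz : S.Perp z u := hu.1
  have huπ : u ∈ π := hu.2
  have hyu : S.Perp y u := by
    intro hc
    have hxu : x ≠ u := by
      rintro rfl
      exact huz ⟨hzx, l, hl, hz, hx⟩
    obtain ⟨_, _, _, _, hd, _⟩ := h
    obtain ⟨ρ, hρ, h1, h2, h3⟩ := hd x y u ⟨hyx.symm, l, hl, hx, hy⟩ hc ⟨hxu, perp_symm' hux⟩
    have hlρ := plane_sub hρ hl hx hy hyx.symm h1 h2
    exact hzx ((hρ.2 l hl hlρ u h3).unique ⟨hz, huz⟩ ⟨hx, perp_symm' hux⟩)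
  obtain ⟨k, hk, hkπ, w, hw, hT⟩ := hT
  have h1 : u ∈ S.perpSet w ∩ π := hT ▸ ⟨hyu, huπ⟩
  have h2 : x ∈ S.perpSet w ∩ π := ⟨perp_trans' hπ (hkπ hw) huπ hxπ h1.1 hux, hxπ⟩
  rw [← hT] at h2
  exact h2.1 ⟨hyx, l, hl, hy, hx⟩

theorem line_three {P : Type u} {S : PLS P} (h : S.Setting) {l : Set P} (hl : l ∈ S.L) (o : P) :
    ∃ a ∈ l, ∃ b ∈ l, a ≠ b ∧ a ≠ o ∧ b ≠ o := by
  obtain ⟨_, ha, _⟩ := h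
  have h4 := ha l hl
  by_contra hc
  push Not at hc
  have hsub : (l \ {o}).Subsingleton := by
    intro a ha b hb
    by_contra hab
    exact hb.2 (hc a ha.1 b hb.1 hab ha.2)
  have h5 : Cardinal.mk ↥(l \ {o}) ≤ 1 := Cardinal.mk_le_one_iff_set_subsingleton.2 hsub
  have h6 : Cardinal.mk ↥l ≤ Cardinal.mk ↥(insert o (l \ {o})) :=
    Cardinal.mk_le_mk_of_subset (fun p hp => by by_cases e : p = o <;> simp [e, hp])
  have h7 : (4 : Cardinal) ≤ 1 + 1 :=
    h4.trans (h6.trans (Cardinal.mk_insert_le.trans (by gcongr)))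
  norm_num at h7

/-- Every transversal has at least two points. -/
theorem two_pts {P : Type u} {S : PLS P} (h : S.Setting) {π : Set P} (hπ : S.IsTransversalPlane π)
    {w : P} (hw : w ∈ π) : ∃ a ∈ π, ∃ b ∈ π, a ≠ b ∧ S.Perp w a ∧ S.Perp w b := by
  obtain ⟨l0, hl0, m0, hm0, hne, ⟨o, hol, hom⟩, hspan⟩ := hπ.1
  have hl0π : l0 ⊆ π := by
    rw [hspan]; exact fun p hp X hX => hX.2 (Or.inl hp)
  have hm0π : m0 ⊆ π := by
    rw [hspan]; exact fun p hp X hX => hX.2 (Or.inr hp)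
  by_cases hwo : S.Perp w o
  · obtain ⟨a, ha, a', ha', haa, hao, hao'⟩ := line_three h hl0 o
    obtain ⟨b, hb, _, _, _, hbo, _⟩ := line_three h hm0 o
    have key : ∀ c ∈ l0, c ≠ o → ¬ S.Perp c b →
        ∃ a ∈ π, ∃ b ∈ π, a ≠ b ∧ S.Perp w a ∧ S.Perp w b := by
      intro c hc hco hcb
      obtain ⟨hcb', k, hk, hck, hbk⟩ := not_not.1 hcb
      obtain ⟨s, ⟨hs, hs'⟩, _⟩ :=
        hπ.2 k hk (plane_sub hπ hk hck hbk hcb' (hl0π hc) (hm0π hb)) w hw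
      refine ⟨o, hl0π hol, s, plane_sub hπ hk hck hbk hcb' (hl0π hc) (hm0π hb) hs, ?_, hwo,
        perp_symm' hs'⟩
      rintro rfl
      exact hne ((S.unique_line l0 hl0 k hk o c hco.symm hol hc hs hck).trans
        (S.unique_line k hk m0 hm0 o b hbo.symm hs hbk hom hb))
    by_cases hab : S.Perp a b
    · refine key a' ha' hao' fun hab' => haa ?_
      exact (hπ.2 l0 hl0 hl0π b (hm0π hb)).unique ⟨ha, hab⟩ ⟨ha', hab'⟩
    · exact key a ha hao hab
  · obtain ⟨a, ⟨ha, ha'⟩, _⟩ := hπ.2 l0 hl0 hl0π w hw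
    obtain ⟨b, ⟨hb, hb'⟩, _⟩ := hπ.2 m0 hm0 hm0π w hw
    refine ⟨a, hl0π ha, b, hm0π hb, ?_, perp_symm' ha', perp_symm' hb'⟩
    rintro rfl
    refine hne (S.unique_line l0 hl0 m0 hm0 a o ?_ ha hol hb hom)
    rintro rfl
    exact hwo (perp_symm' ha')

/-- If `y^⊥` contains two points on different lines through `x`, then so does `z^⊥`. -/
theorem cases_of {P : Type u} {S : PLS P} (h : S.Setting) {π : Set P}
    (hπ : S.IsTransversalPlane π) {l : Set P} (hl : l ∈ S.L)
    {x y z : P} (hx : x ∈ l) (hy : y ∈ l) (hz : z ∈ l) (hyx : y ≠ x) (hzx : z ≠ x)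
    (hxπ : x ∈ π) (hyπ : y ∉ π) {t t' : P} (ht : t ∈ π) (ht' : t' ∈ π)
    (hyt : S.Perp y t) (hyt' : S.Perp y t') {k k' : Set P} (hk : k ∈ S.L) (hk' : k' ∈ S.L)
    (hxk : x ∈ k) (hxk' : x ∈ k') (htk : t ∈ k) (htk' : t' ∈ k') (hxt : x ≠ t) (hxt' : x ≠ t')
    (hkk : k ≠ k') :
    S.perpSet z ∩ π ∈ S.L ∨ S.IsTransversalOf (S.perpSet z ∩ π) π := by
  obtain ⟨s, hs, hsx, hzs⟩ := proj_pt h hl hx hy hz hyx hzx hk hxk htk hxt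
    (fun e => hyπ (e ▸ ht)) hyt
  obtain ⟨s', hs', hsx', hzs'⟩ := proj_pt h hl hx hy hz hyx hzx hk' hxk' htk' hxt'
    (fun e => hyπ (e ▸ ht')) hyt'
  have m1 : s ∈ S.perpSet z ∩ π := ⟨hzs, plane_sub hπ hk hxk htk hxt hxπ ht hs⟩
  have m2 : s' ∈ S.perpSet z ∩ π := ⟨hzs', plane_sub hπ hk' hxk' htk' hxt' hxπ ht' hs'⟩
  have hss : s ≠ s' := by
    rintro rfl
    exact hkk (S.unique_line k hk k' hk' x s hsx.symm hxk hs hxk' hs')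
  obtain ⟨_, _, _, _, _, he⟩ := h
  rcases he z π hπ with h0 | ⟨q, h1⟩ | h2 | h3 | h4
  · rw [h0] at m1; exact m1.elim
  · rw [h1] at m1 m2
    exact (hss (m1.trans m2.symm)).elim
  · exact Or.inl h2
  · exact Or.inr h3
  · have : x ∈ S.perpSet z ∩ π := by rw [h4]; exact hxπ
    exact (this.1 ⟨hzx, l, hl, hz, hx⟩).elim

end PLS

/-- 3.6. In the Setting, let `π` be a transversal plane and
`l` a line meeting `π` exactly in the point `x`. If for some `y ∈ l ∖ {x}` the
set `y^⊥ ∩ π` is a transversal of `π`, then this holds for all `y ∈ l ∖ {x}`;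
and likewise with "a line of `Π` (contained in `π`)" in place of "a
transversal of `π`". -/
theorem line_meets_plane {P : Type u} (S : PLS P) (h : S.Setting)
    (π : Set P) (hπ : S.IsTransversalPlane π)
    (l : Set P) (hl : l ∈ S.L) (x : P) (hx : l ∩ π = {x}) :
    ((∃ y ∈ l, y ≠ x ∧ S.IsTransversalOf (S.perpSet y ∩ π) π) →
      ∀ y ∈ l, y ≠ x → S.IsTransversalOf (S.perpSet y ∩ π) π) ∧
    ((∃ y ∈ l, y ≠ x ∧ S.perpSet y ∩ π ∈ S.L) →
      ∀ y ∈ l, y ≠ x → S.perpSet y ∩ π ∈ S.L) := by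
  have hxx : x ∈ l ∩ π := hx ▸ rfl
  obtain ⟨hxl, hxπ⟩ := hxx
  have hout : ∀ y ∈ l, y ≠ x → y ∉ π := fun y hy hyx hyπ => hyx (by
    have : y ∈ l ∩ π := ⟨hy, hyπ⟩
    rw [hx] at this; exact this)
  constructor
  · rintro ⟨y, hy, hyx, hT⟩ z hz hzx
    have hT0 := hT
    obtain ⟨k0, hk0, hk0π, w, hw, hT⟩ := hT
    obtain ⟨t, ht, t', ht', htt, hwt, hwt'⟩ := PLS.two_pts h hπ (hk0π hw)
    have h1 : t ∈ S.perpSet y ∩ π := hT ▸ ⟨hwt, ht⟩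
    have h2 : t' ∈ S.perpSet y ∩ π := hT ▸ ⟨hwt', ht'⟩
    have hcol : ∀ s ∈ π, S.Perp w s → S.Collinear x s := by
      intro s hs hws
      by_contra hc
      have : x ∈ S.perpSet w ∩ π :=
        ⟨PLS.perp_trans' hπ (hk0π hw) hs hxπ hws (PLS.perp_symm' hc), hxπ⟩
      rw [← hT] at this
      exact this.1 ⟨hyx, l, hl, hy, hxl⟩
    obtain ⟨n1, k, hk, hxk, htk⟩ := hcol t ht hwt
    obtain ⟨n2, k', hk', hxk', htk'⟩ := hcol t' ht' hwt'
    have hkk : k ≠ k' := by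
      rintro rfl
      exact PLS.perp_trans' hπ ht (hk0π hw) ht' (PLS.perp_symm' hwt) hwt' ⟨htt, k, hk, htk, htk'⟩
    rcases PLS.cases_of h hπ hl hxl hy hz hyx hzx hxπ (hout y hy hyx) ht ht' h1.1 h2.1 hk hk'
      hxk hxk' htk htk' n1 n2 hkk with h3 | h3
    · exact (PLS.excl h hπ hl hxl hy hz hyx hzx hxπ (hout y hy hyx) hT0 h3).elim
    · exact h3
  · rintro ⟨y, hy, hyx, hm⟩ z hz hzx
    obtain ⟨u, ⟨hu, hux⟩, huu⟩ := hπ.2 _ hm Set.inter_subset_right x hxπ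
    obtain ⟨t, ht, t', ht', htt, htu, htu'⟩ := PLS.line_three h hm u
    have hcol : ∀ s ∈ S.perpSet y ∩ π, s ≠ u → S.Collinear x s := by
      intro s hs hsu
      by_contra hc
      exact hsu (huu s ⟨hs, PLS.perp_symm' hc⟩)
    obtain ⟨n1, k, hk, hxk, htk⟩ := hcol t ht htu
    obtain ⟨n2, k', hk', hxk', htk'⟩ := hcol t' ht' htu'
    have hkk : k ≠ k' := by
      rintro rfl
      have hkm := S.unique_line k hk _ hm t t' htt htk htk' ht ht'
      have hxm : x ∈ S.perpSet y ∩ π := hkm ▸ hxk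
      exact hxm.1 ⟨hyx, l, hl, hy, hxl⟩
    rcases PLS.cases_of h hπ hl hxl hy hz hyx hzx hxπ (hout y hy hyx) ht.2 ht'.2 ht.1 ht'.1 hk hk'
      hxk hxk' htk htk' n1 n2 hkk with h3 | h3
    · exact h3
    · exact (PLS.excl h hπ hl hxl hz hy hzx hyx hxπ (hout z hz hzx) h3 hm).elim
end

section
/- Let Π=(P,L) be a connected partial linear space satisfying conditions (a)–(e) of the Setting. Let x and y be two distinct non-collinear points, and let z₁≠z₂ be two collinear points each collinear with both x and y. If there is a line ℓ of Π contained in z₁^⊥ meeting both the line z₂x and the line z₂y, then there is a line m of Π contained in z₂^⊥ meeting both the line z₁x and the line z₁y. -/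
universe u

namespace PLS

variable {P : Type u} {S : PLS P}

lemma psymm {x y : P} (h : S.Perp x y) : S.Perp y x :=
  fun ⟨hn, l, hl, a, b⟩ => h ⟨hn.symm, l, hl, b, a⟩

lemma csymm {x y : P} (h : S.Collinear x y) : S.Collinear y x :=
  let ⟨hn, l, hl, a, b⟩ := h; ⟨hn.symm, l, hl, b, a⟩

lemma eq_of_line {l : Set P} (hl : l ∈ S.L) {p q : P} (hp : p ∈ l) (hq : q ∈ l)
    (h : S.Perp p q) : p = q := by
  by_contra hn
  exact h ⟨hn, l, hl, hp, hq⟩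

lemma tp_line {X l : Set P} (hX : S.IsTransversalPlane X) (hl : l ∈ S.L) {p q : P}
    (hp : p ∈ l) (hq : q ∈ l) (hpX : p ∈ X) (hqX : q ∈ X) (hn : p ≠ q) : l ⊆ X := by
  obtain ⟨⟨l1, _, l2, _, _, _, rfl⟩, _⟩ := hX
  intro r hr Y hY
  exact hY.1 l hl ⟨p, ⟨hp, hpX Y hY⟩, q, ⟨hq, hqX Y hY⟩, hn⟩ hr

lemma tp_trans {X : Set P} (hX : S.IsTransversalPlane X) {p q r : P} (hp : p ∈ X)
    (hq : q ∈ X) (hr : r ∈ X) (h1 : S.Perp p q) (h2 : S.Perp q r) : S.Perp p r := by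
  rintro ⟨hn, l, hl, hpl, hrl⟩
  obtain ⟨s, _, hs⟩ := hX.2 l hl (tp_line hX hl hpl hrl hp hr hn) q hq
  exact hn ((hs p ⟨hpl, h1⟩).trans (hs r ⟨hrl, psymm h2⟩).symm)

lemma two_pts_s9 (h : S.Setting) {X : Set P} (hX : S.IsTransversalPlane X) {w p q : P}
    (hp : p ∈ X) (hq : q ∈ X) (hn : p ≠ q) (h1 : S.Perp w p) (h2 : S.Perp w q) :
    (S.perpSet w ∩ X ∈ S.L) ∨ (∃ t ∈ X, S.perpSet w ∩ X = S.perpSet t ∩ X) ∨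
      (∀ r ∈ X, S.Perp w r) := by
  have hp' : p ∈ S.perpSet w ∩ X := ⟨h1, hp⟩
  have hq' : q ∈ S.perpSet w ∩ X := ⟨h2, hq⟩
  rcases h.2.2.2.2.2 w X hX with h | ⟨s, h⟩ | h | ⟨l, hl, hlX, t, ht, h⟩ | h
  · rw [h] at hp'; exact hp'.elim
  · rw [h] at hp' hq'; exact (hn (hp'.trans hq'.symm)).elim
  · exact Or.inl h
  · exact Or.inr (Or.inl ⟨t, hlX ht, h⟩)
  · refine Or.inr (Or.inr fun r hr => ?_)
    rw [← h] at hr; exact hr.1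

lemma two_col (h : S.Setting) {X : Set P} (hX : S.IsTransversalPlane X) {w p q : P}
    (hp : p ∈ X) (hq : q ∈ X) (hc : S.Collinear p q) (h1 : S.Perp w p) (h2 : S.Perp w q) :
    (S.perpSet w ∩ X ∈ S.L) ∨ (∀ r ∈ X, S.Perp w r) := by
  rcases two_pts_s9 h hX hp hq hc.1 h1 h2 with h | ⟨t, ht, h⟩ | h
  · exact Or.inl h
  · have hp' : p ∈ S.perpSet w ∩ X := ⟨h1, hp⟩
    have hq' : q ∈ S.perpSet w ∩ X := ⟨h2, hq⟩
    rw [h] at hp' hq'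
    exact (tp_trans hX hp ht hq (psymm hp'.1) hq'.1 hc).elim
  · exact Or.inr h

lemma two_perp (h : S.Setting) {X : Set P} (hX : S.IsTransversalPlane X) {w p q r : P}
    (hp : p ∈ X) (hq : q ∈ X) (hn : p ≠ q) (hpq : S.Perp p q) (h1 : S.Perp w p)
    (h2 : S.Perp w q) (hr : r ∈ X) (hpr : S.Perp p r) : S.Perp w r := by
  have hp' : p ∈ S.perpSet w ∩ X := ⟨h1, hp⟩
  have hq' : q ∈ S.perpSet w ∩ X := ⟨h2, hq⟩
  rcases two_pts_s9 h hX hp hq hn h1 h2 with h | ⟨t, ht, h⟩ | h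
  · exact (hn (eq_of_line h hp' hq' hpq)).elim
  · rw [h] at hp'
    have : r ∈ S.perpSet w ∩ X := by
      rw [h]; exact ⟨tp_trans hX ht hp hr hp'.1 hpr, hr⟩
    exact this.1
  · exact h r hr

lemma three_perp (h : S.Setting) {X : Set P} (hX : S.IsTransversalPlane X) {w p q s : P}
    (hp : p ∈ X) (hq : q ∈ X) (hn : p ≠ q) (hpq : S.Perp p q) (h1 : S.Perp w p)
    (h2 : S.Perp w q) (hs : s ∈ X) (hps : S.Collinear p s) (h3 : S.Perp w s) :
    ∀ r ∈ X, S.Perp w r := by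
  rcases two_col h hX hp hs hps h1 h3 with h | h
  · exact (hn (eq_of_line h ⟨h1, hp⟩ ⟨h2, hq⟩ hpq)).elim
  · exact h

end PLS

open PLS in
theorem intersection_of_planes {P : Type u} (S : PLS P) (h : S.Setting)
    (x y z₁ z₂ : P) (hxy : x ≠ y) (hncol : ¬ S.Collinear x y)
    (hz : z₁ ≠ z₂) (hz12 : S.Collinear z₁ z₂)
    (hz1x : S.Collinear z₁ x) (hz1y : S.Collinear z₁ y)
    (hz2x : S.Collinear z₂ x) (hz2y : S.Collinear z₂ y)
    (hℓ : ∃ ℓ ∈ S.L, ℓ ⊆ S.perpSet z₁ ∧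
      (∃ m ∈ S.L, z₂ ∈ m ∧ x ∈ m ∧ (ℓ ∩ m).Nonempty) ∧
      (∃ m ∈ S.L, z₂ ∈ m ∧ y ∈ m ∧ (ℓ ∩ m).Nonempty)) :
    ∃ m ∈ S.L, m ⊆ S.perpSet z₂ ∧
      (∃ n ∈ S.L, z₁ ∈ n ∧ x ∈ n ∧ (m ∩ n).Nonempty) ∧
      (∃ n ∈ S.L, z₁ ∈ n ∧ y ∈ n ∧ (m ∩ n).Nonempty) := by
  have hpxy : S.Perp x y := hncol
  obtain ⟨ℓ, hℓL, hℓp, ⟨A, hA, hz2A, hxA, a, haℓ, haA⟩, ⟨B, hB, hz2B, hyB, b, hbℓ, hbB⟩⟩ := hℓ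
  have ha1 : S.Perp z₁ a := hℓp haℓ
  have hb1 : S.Perp z₁ b := hℓp hbℓ
  have haz2 : a ≠ z₂ := by rintro rfl; exact ha1 hz12
  have hbz2 : b ≠ z₂ := by rintro rfl; exact hb1 hz12
  have hyA : y ∉ A := fun hy => hncol ⟨hxy, A, hA, hxA, hy⟩
  have hab : a ≠ b := by
    rintro rfl
    exact hyA (S.unique_line A hA B hB a z₂ haz2 haA hz2A hbB hz2B ▸ hyB)
  have hz1ℓ : z₁ ∉ ℓ := by
    intro hz
    exact hab ((eq_of_line hℓL hz haℓ ha1).symm.trans (eq_of_line hℓL hz hbℓ hb1))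
  have haz1 : a ≠ z₁ := by rintro rfl; exact hz1ℓ haℓ
  have hbz1 : b ≠ z₁ := by rintro rfl; exact hz1ℓ hbℓ
  have hD := h.2.2.2.2.1
  obtain ⟨π2, hπ2, hx2, hz22, hy2⟩ := hD x z₂ y (csymm hz2x) hz2y ⟨hxy, hpxy⟩
  obtain ⟨π1, hπ1, hx1, hz11, hy1⟩ := hD x z₁ y (csymm hz1x) hz1y ⟨hxy, hpxy⟩
  have ha2 : a ∈ π2 := tp_line hπ2 hA hz2A hxA hz22 hx2 hz2x.1 haA
  have hb2 : b ∈ π2 := tp_line hπ2 hB hz2B hyB hz22 hy2 hz2y.1 hbB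
  have hℓ2 : ℓ ⊆ π2 := tp_line hπ2 hℓL haℓ hbℓ ha2 hb2 hab
  obtain ⟨u, ⟨huℓ, hux⟩, -⟩ := hπ2.2 ℓ hℓL hℓ2 x hx2
  have hu2 := hℓ2 huℓ
  have hu1 : S.Perp z₁ u := hℓp huℓ
  have huy : S.Perp u y := tp_trans hπ2 hu2 hx2 hy2 hux hpxy
  have huz2 : S.Collinear u z₂ := by
    by_contra hc
    exact tp_trans hπ2 hx2 hu2 hz22 (psymm hux) hc (csymm hz2x)
  have huz1 : u ≠ z₁ := by rintro rfl; exact hz1ℓ huℓ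
  obtain ⟨πx, hπx, hax, hz2πx, hz1πx⟩ := hD a z₂ z₁ ⟨haz2, A, hA, haA, hz2A⟩ (csymm hz12)
    ⟨haz1, psymm ha1⟩
  obtain ⟨πy, hπy, hby, hz2πy, hz1πy⟩ := hD b z₂ z₁ ⟨hbz2, B, hB, hbB, hz2B⟩ (csymm hz12)
    ⟨hbz1, psymm hb1⟩
  have hxπx : x ∈ πx := tp_line hπx hA haA hz2A hax hz2πx haz2 hxA
  have hyπy : y ∈ πy := tp_line hπy hB hbB hz2B hby hz2πy hbz2 hyB
  obtain ⟨τ, hτ, huτ, hz2τ, hz1τ⟩ := hD u z₂ z₁ huz2 (csymm hz12) ⟨huz1, psymm hu1⟩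
  obtain ⟨-, C, hC, hz1C, hxC⟩ := id hz1x
  obtain ⟨-, D, hDL, hz1D, hyD⟩ := id hz1y
  obtain ⟨-, Z, hZ, hz1Z, hz2Z⟩ := id hz12
  obtain ⟨c, ⟨hcC, hcz2⟩, -⟩ := hπx.2 C hC (tp_line hπx hC hz1C hxC hz1πx hxπx hz1x.1) z₂ hz2πx
  obtain ⟨d, ⟨hdD, hdz2⟩, -⟩ := hπy.2 D hDL (tp_line hπy hDL hz1D hyD hz1πy hyπy hz1y.1) z₂ hz2πy
  have hc1 : c ∈ π1 := tp_line hπ1 hC hz1C hxC hz11 hx1 hz1x.1 hcC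
  have hd1 : d ∈ π1 := tp_line hπ1 hDL hz1D hyD hz11 hy1 hz1y.1 hdD
  have hcz1 : c ≠ z₁ := by rintro rfl; exact hcz2 hz12
  have hcd : c ≠ d := by
    rintro rfl
    have e := S.unique_line C hC D hDL c z₁ hcz1 hcC hz1C hdD hz1D
    exact hncol ⟨hxy, D, hDL, e ▸ hxC, hyD⟩
  rcases two_pts_s9 h hπ1 hc1 hd1 hcd (psymm hcz2) (psymm hdz2) with hm | ⟨t0, ht0, hT⟩ | hall
  · exact ⟨_, hm, fun _ hp => hp.1, ⟨C, hC, hz1C, hxC, c, ⟨psymm hcz2, hc1⟩, hcC⟩,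
      ⟨D, hDL, hz1D, hyD, d, ⟨psymm hdz2, hd1⟩, hdD⟩⟩
  · exfalso
    obtain ⟨k, ⟨hkZ, hkx⟩, -⟩ :=
      hπx.2 Z hZ (tp_line hπx hZ hz1Z hz2Z hz1πx hz2πx hz) x hxπx
    have hkπy : k ∈ πy := tp_line hπy hZ hz1Z hz2Z hz1πy hz2πy hz hkZ
    have hkz1 : k ≠ z₁ := by rintro rfl; exact hkx hz1x
    have hkz2 : k ≠ z₂ := by rintro rfl; exact hkx hz2x
    have hZτ : Z ⊆ τ := tp_line hτ hZ hz1Z hz2Z hz1τ hz2τ hz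
    obtain ⟨k', ⟨hk'D, hk'⟩, -⟩ :=
      hπy.2 D hDL (tp_line hπy hDL hz1D hyD hz1πy hyπy hz1y.1) k hkπy
    have hk'1 : k' ∈ π1 := tp_line hπ1 hDL hz1D hyD hz11 hy1 hz1y.1 hk'D
    have hxk' : x ≠ k' := by
      rintro rfl; exact hncol ⟨hxy, D, hDL, hk'D, hyD⟩
    have hcT : S.Perp t0 c := by
      have : c ∈ S.perpSet z₂ ∩ π1 := ⟨psymm hcz2, hc1⟩
      rw [hT] at this; exact this.1
    rcases two_pts_s9 h hπ1 hx1 hk'1 hxk' hkx (psymm hk') with hg | ⟨s0, hs0, hs⟩ | hall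
    · obtain ⟨t, ⟨htg, htt0⟩, -⟩ := hπ1.2 _ hg (fun _ hp => hp.2) t0 ht0
      have htz2 : S.Perp z₂ t := by
        have : t ∈ S.perpSet z₂ ∩ π1 := by rw [hT]; exact ⟨psymm htt0, htg.2⟩
        exact this.1
      have htu : S.Perp u t := three_perp h hπ1 hx1 hy1 hxy hpxy hux huy hz11 (csymm hz1x)
        (psymm hu1) t htg.2
      have htk : S.Perp k t := htg.1
      rcases two_col h hτ huτ hz2τ huz2 (psymm htu) (psymm htz2) with hl | hl
      · have e := S.unique_line _ hl Z hZ k z₂ hkz2 ⟨psymm htk, hZτ hkZ⟩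
          ⟨psymm htz2, hz2τ⟩ hkZ hz2Z
        have huZ : u ∈ Z := by rw [← e]; exact ⟨psymm htu, huτ⟩
        exact huz1 (eq_of_line hZ hz1Z huZ hu1).symm
      · have h1 : S.Perp t z₁ := hl z₁ hz1τ
        have h2 : S.Perp c t := tp_trans hπ1 hc1 ht0 htg.2 (psymm hcT) (psymm htt0)
        exact hcz1 (eq_of_line hC hcC hz1C (tp_trans hπ1 hc1 htg.2 hz11 h2 h1))
    · have hs0x : S.Perp s0 x := by
        have : x ∈ S.perpSet k ∩ π1 := ⟨hkx, hx1⟩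
        rw [hs] at this; exact this.1
      have hky : S.Perp k y := by
        have : y ∈ S.perpSet k ∩ π1 := by
          rw [hs]; exact ⟨tp_trans hπ1 hs0 hx1 hy1 hs0x hpxy, hy1⟩
        exact this.1
      have hku : S.Perp k u := two_perp h hπ2 hx2 hy2 hxy hpxy hkx hky hu2 (psymm hux)
      exact hkz1 (eq_of_line hZ hkZ hz1Z (tp_trans hτ (hZτ hkZ) huτ hz1τ hku (psymm hu1)))
    · exact hkz1 (eq_of_line hZ hkZ hz1Z (hall z₁ hz11))
  · exact (hall x hx1 hz2x).elim
end
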